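/- Let p be a prime, n ≥ 1, q = p^n, k a divisor of n, v > 1 a divisor of p^k − 1, and let U be an 𝔽_{p^k}-subspace of 𝔽_q with 1 ∈ U, #U = p^{mk}, and #U^v > 2. If U ≠ {c ∈ 𝔽_q : c^{p^{mk}} = c} (i.e., U is not the subfield 𝔽_{p^{mk}}), then m > 1, and every F ∈ 𝒫(U^v, q) that is not of the form f^v with f ∈ 𝒫(U, q) satisfies deg F > (√(p^n) + 1)·p^{mk}, as an inequality of real numbers. -/

import Mathlib

open Polynomial

/-- The value set of a polynomial over a finite field. -/
def valueSet {F : Type*} [Field F] [Fintype F] [DecidableEq F] (f : F[X]) : Finset F :=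
  Finset.image (fun a => f.eval a) Finset.univ

/-- A minimal value set polynomial (MVSP): a nonconstant polynomial whose value set has
the minimal possible size `⌊(q-1)/deg f⌋ + 1`. -/
def IsMVSP {F : Type*} [Field F] [Fintype F] [DecidableEq F] (f : F[X]) : Prop :=
  0 < f.natDegree ∧ (valueSet f).card = (Fintype.card F - 1) / f.natDegree + 1

/-- `MVSPset S` is the set `𝒫(S, q)` of all MVSPs with value set `S`. -/
def MVSPset {F : Type*} [Field F] [Fintype F] [DecidableEq F] (S : Finset F) : Set F[X] :=
  {f | IsMVSP f ∧ valueSet f = S}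

/-- `U` is a subspace over the subfield `{c : c ^ r = c}` (with `r = p ^ k`):
an additive subgroup closed under multiplication by elements of that subfield. -/
def IsSubspaceOver {F : Type*} [Field F] (r : ℕ) (U : Set F) : Prop :=
  (0 : F) ∈ U ∧ (∀ x ∈ U, ∀ y ∈ U, x + y ∈ U) ∧ (∀ x ∈ U, -x ∈ U) ∧
    (∀ c : F, c ^ r = c → ∀ x ∈ U, c * x ∈ U)

/-- An `r`-linearized polynomial (with `r = q` or `r = p ^ k`): of the form `Σ aᵢ x ^ (r ^ i)`. -/
def IsLinearized {F : Type*} [Field F] (r : ℕ) (M : F[X]) : Prop :=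
  ∃ (s : ℕ) (a : ℕ → F), M = ∑ i ∈ Finset.range (s + 1), C (a i) * X ^ r ^ i

namespace MV

/-- numbers whose base-`h` digits are 0 or 1 with no two adjacent ones -/
inductive Good (h : ℕ) : ℕ → Prop
  | zero : Good h 0
  | shift (A : ℕ) : Good h A → Good h (h * A)
  | one (A : ℕ) : Good h A → Good h (h * h * A + 1)

lemma good_bound {h : ℕ} (hh : 3 ≤ h) {A : ℕ} (hA : Good h A) :
    ∀ l, A < h ^ l → (h * h - 1) * A + 1 ≤ h ^ (l + 1) := by
  obtain ⟨g, rfl⟩ : ∃ g, h = g + 1 := ⟨h - 1, by omega⟩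
  have e1 : (g + 1) * (g + 1) - 1 = g * g + 2 * g := by
    have : (g + 1) * (g + 1) = g * g + 2 * g + 1 := by ring
    omega
  rw [e1]
  induction hA with
  | zero => intro l _; simpa using Nat.one_le_pow _ _ (by omega)
  | shift A _ ih =>
    intro l hl
    rcases l with _ | l
    · have : A = 0 := by
        rw [pow_zero] at hl
        rcases Nat.eq_zero_or_pos A with h0 | h0
        · exact h0
        · have := Nat.mul_pos (show 0 < g + 1 by omega) h0
          omega
      subst this
      simp
    · have h2 : A < (g + 1) ^ l := by
        rw [pow_succ'] at hl
        exact Nat.lt_of_mul_lt_mul_left hl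
      have := ih l h2
      rw [pow_succ' _ (l + 1)]
      nlinarith
  | one A _ ih =>
    intro l hl
    rcases l with _ | _ | l
    · simp at hl
    · have h0 : A = 0 := by
        rcases Nat.eq_zero_or_pos A with h0 | h0
        · exact h0
        · exfalso
          simp only [zero_add, pow_one] at hl
          have : (g + 1) * (g + 1) * 1 ≤ (g + 1) * (g + 1) * A := Nat.mul_le_mul_left _ h0
          nlinarith
      subst h0
      simp only [zero_add, mul_zero, mul_one]
      have e3 : (g + 1) ^ (1 + 1) = g * g + 2 * g + 1 := by ring
      rw [e3]
    · have h2 : A < (g + 1) ^ l := by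
        rw [pow_succ', pow_succ', ← mul_assoc] at hl
        exact Nat.lt_of_mul_lt_mul_left (Nat.lt_of_succ_lt hl)
      have := ih l h2
      have e2 : (g + 1) ^ (l + 1 + 1 + 1) = (g + 1) * (g + 1) * (g + 1) ^ (l + 1) := by ring
      rw [e2]
      have := Nat.mul_le_mul_left ((g + 1) * (g + 1)) this
      nlinarith

lemma good_dvd {h p A : ℕ} (hp : p.Prime) (hph : p ∣ h) (hA : Good h A) (hd : p ∣ A) :
    ∃ A', Good h A' ∧ A = h * A' := by
  cases hA with
  | zero => exact ⟨0, Good.zero, by simp⟩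
  | shift A' h' => exact ⟨A', h', rfl⟩
  | one A' h' =>
    exfalso
    have : p ∣ h * h * A' := Dvd.dvd.mul_right (Dvd.dvd.mul_right hph _) _
    have := (Nat.dvd_add_right this).1 hd
    exact hp.one_lt.ne' (Nat.dvd_one.1 this)

lemma good_not_dvd {h p A : ℕ} (hph : p ∣ h) (hA : Good h A) (hd : ¬ p ∣ A) :
    p ∣ A - 1 := by
  cases hA with
  | zero => simp at hd
  | shift A' h' => exact absurd (Dvd.dvd.mul_right hph _) hd
  | one A' h' =>
    simpa using Dvd.dvd.mul_right (Dvd.dvd.mul_right hph _) _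

lemma lucas_pow {p : ℕ} [Fact p.Prime] (j : ℕ) : ∀ n r : ℕ,
    n.choose r ≡ (n % p ^ j).choose (r % p ^ j) * (n / p ^ j).choose (r / p ^ j) [MOD p] := by
  induction j with
  | zero => intro n r; simp [Nat.mod_one]; rfl
  | succ j ih =>
    intro n r
    have h1 := Choose.choose_modEq_choose_mod_mul_choose_div_nat (n := n) (k := r) (p := p)
    have h2 := ih (n / p) (r / p)
    have h3 := Choose.choose_modEq_choose_mod_mul_choose_div_nat (n := n % p ^ (j+1))
      (k := r % p ^ (j+1)) (p := p)
    have e : ∀ a : ℕ, a % p ^ (j+1) % p = a % p := fun a =>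
      Nat.mod_mod_of_dvd _ (dvd_pow_self _ (by omega))
    have e2 : ∀ a : ℕ, a % p ^ (j+1) / p = a / p % p ^ j := fun a => by
      rw [pow_succ', Nat.mod_mul_right_div_self]
    have e3 : ∀ a : ℕ, a / p / p ^ j = a / p ^ (j+1) := fun a => by
      rw [pow_succ', Nat.div_div_eq_div_mul]
    rw [e, e, e2, e2] at h3
    rw [e3, e3] at h2
    calc _ ≡ _ [MOD p] := h1
      _ ≡ _ [MOD p] := Nat.ModEq.mul_left _ h2
      _ ≡ _ [MOD p] := by rw [← mul_assoc]; exact Nat.ModEq.mul_right _ h3.symm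

lemma choose_ne {p : ℕ} [Fact p.Prime] (j K x : ℕ) (hx : x < p ^ j) (hK : K ≡ x [MOD p ^ j]) :
    ¬ p ∣ K.choose x := by
  have h := lucas_pow (p := p) j K x
  rw [Nat.mod_eq_of_lt hx, Nat.div_eq_of_lt hx, Nat.choose_zero_right, mul_one, hK,
    Nat.mod_eq_of_lt hx, Nat.choose_self] at h
  intro hd
  have := (Nat.modEq_zero_iff_dvd.2 hd).symm.trans h
  have h2 := (Nat.modEq_zero_iff_dvd.1 this.symm)
  exact (Fact.out : p.Prime).one_lt.ne' (Nat.dvd_one.1 h2)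

section hasse
variable {F : Type*} [Field F]

lemma hasse_map {E : Type*} [Field E] (i : F →+* E) (k : ℕ) (f : F[X]) :
    hasseDeriv k (f.map i) = (hasseDeriv k f).map i := by
  ext n; simp [hasseDeriv_coeff]

/-- the bivariate Taylor expansion -/
noncomputable def Phi (g : F[X]) : F[X][X] := taylor (X : F[X]) (g.map C)

lemma Phi_coeff (g : F[X]) (A : ℕ) : (Phi g).coeff A = hasseDeriv A g := by
  have : hasseDeriv A (g.map (C : F →+* F[X])) = (hasseDeriv A g).map C := by
    ext n; simp [hasseDeriv_coeff]
  rw [Phi, taylor_coeff, this, eval_map, eval₂_C_X]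

lemma hasse_pow (p : ℕ) [Fact p.Prime] [CharP F p] (j A : ℕ) (g : F[X]) :
    hasseDeriv A (g ^ p ^ j) = if p ^ j ∣ A then (hasseDeriv (A / p ^ j) g) ^ p ^ j else 0 := by
  have h1 : Phi (g ^ p ^ j) = (Phi g) ^ p ^ j := by
    simp [Phi, Polynomial.map_pow, taylor_pow]
  rw [← Phi_coeff, h1, ← map_iterateFrobenius_expand p, coeff_map,
    coeff_expand (pow_pos (Fact.out : p.Prime).pos j)]
  split_ifs with h
  · rw [iterateFrobenius_def, Phi_coeff]
  · simp

lemma hasse_mul_pow (p : ℕ) [Fact p.Prime] [CharP F p] (j s : ℕ) (hs : s < p ^ j) (g J : F[X]) :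
    hasseDeriv s (g * J ^ p ^ j) = hasseDeriv s g * J ^ p ^ j := by
  rw [hasseDeriv_mul, Finset.sum_eq_single (s, 0)]
  · simp
  · rintro ⟨a, b⟩ hab hne
    rw [Finset.HasAntidiagonal.mem_antidiagonal] at hab
    simp only at hab ⊢
    have hb : b ≠ 0 := by
      rintro rfl; apply hne; simp at hab; simp [hab]
    rw [hasse_pow, if_neg, mul_zero]
    intro hd
    have := Nat.le_of_dvd (Nat.pos_of_ne_zero hb) hd
    omega
  · intro h; simp at h

lemma hasse_XXq (p : ℕ) [Fact p.Prime] [CharP F p] (n A : ℕ) (hA : 0 < A) (hA2 : A < p ^ n)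
    (g : F[X]) :
    hasseDeriv A ((X - X ^ p ^ n) * g) = (X - X ^ p ^ n) * hasseDeriv A g + hasseDeriv (A - 1) g := by
  obtain ⟨B, rfl⟩ : ∃ B, A = B + 1 := ⟨A - 1, by omega⟩
  have h2 : hasseDeriv (B+1) (X * g) = X * hasseDeriv (B+1) g + hasseDeriv B g := by
    ext n
    rcases n with _ | n
    · simp [hasseDeriv_coeff, coeff_X_mul]
    · simp only [hasseDeriv_coeff, coeff_X_mul, coeff_add]
      have e1 : n + 1 + (B + 1) = (n + (B + 1)) + 1 := by ring
      have e2 : n + 1 + B = n + (B + 1) := by ring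
      rw [e1, coeff_X_mul, e2]
      rw [Nat.choose_succ_succ]
      push_cast; ring
  have h3 := hasse_mul_pow p n (B+1) hA2 g X
  rw [sub_mul, map_sub, h2, mul_comm (X ^ p ^ n) g, h3]
  simp only [Nat.add_sub_cancel]
  ring

lemma hasse_deriv (A : ℕ) (g : F[X]) :
    hasseDeriv A (derivative g) = ((A + 1 : ℕ) : F[X]) * hasseDeriv (A + 1) g := by
  have := congrArg (fun T => T g) (hasseDeriv_comp (R := F) A 1)
  simp only [LinearMap.comp_apply, hasseDeriv_one', LinearMap.smul_apply] at this
  rw [this]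
  simp [nsmul_eq_mul]

lemma prod_dvd_hasse (R : F[X]) (S : Multiset F[X]) (hS : ∀ P ∈ S, P ∣ R) :
    ∀ (s : ℕ) (g : F[X]), S.prod ∣ R ^ s * hasseDeriv s (g * S.prod) := by
  induction S using Multiset.induction with
  | empty => intro s g; simp
  | cons P S ih =>
    intro s g
    have ih' := ih (fun Q hQ => hS Q (Multiset.mem_cons_of_mem hQ))
    have hP := hS P (Multiset.mem_cons_self _ _)
    rw [Multiset.prod_cons, show g * (P * S.prod) = P * (g * S.prod) by ring, hasseDeriv_mul,
      Finset.mul_sum]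
    refine Finset.dvd_sum ?_
    rintro ⟨a, b⟩ hab
    rw [Finset.HasAntidiagonal.mem_antidiagonal] at hab
    simp only at hab ⊢
    rw [← hab, pow_add, show R ^ a * R ^ b * (hasseDeriv a P * hasseDeriv b (g * S.prod)) =
      (R ^ a * hasseDeriv a P) * (R ^ b * hasseDeriv b (g * S.prod)) by ring]
    refine mul_dvd_mul ?_ (ih' b g)
    rcases a with _ | a
    · simp
    · rw [pow_succ']
      exact Dvd.dvd.mul_right (Dvd.dvd.mul_right hP _) _

lemma hasse_taylor {E : Type*} [Field E] [Infinite E] (k : ℕ) (r : E) (f : E[X]) :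
    hasseDeriv k (taylor r f) = taylor r (hasseDeriv k f) := by
  apply Polynomial.funext
  intro s
  rw [← taylor_coeff, taylor_taylor, taylor_coeff, taylor_eval]

lemma hasse_ne_zero {E : Type*} [Field E] [Infinite E] (b : E) (K x : ℕ) (hx : x ≤ K)
    (hc : ((K.choose x : ℕ) : E) ≠ 0) (J : E[X]) (hJ : J.eval b ≠ 0) :
    hasseDeriv x ((X - C b) ^ K * J) ≠ 0 := by
  intro h
  have h2 := hasse_taylor x b ((X - C b) ^ K * J)
  rw [h, map_zero, taylor_mul, taylor_pow] at h2
  have h3 : taylor b (X - C b) = X := by simp [taylor_apply]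
  rw [h3] at h2
  have h4 := congrArg (fun f => coeff f (K - x)) h2
  simp only [hasseDeriv_coeff, coeff_zero] at h4
  rw [Nat.sub_add_cancel hx] at h4
  have h5 := coeff_X_pow_mul (taylor b J) K 0
  rw [zero_add] at h5
  rw [h5, taylor_coeff_zero] at h4
  exact mul_ne_zero hc hJ h4

end hasse

lemma wdef {v h : ℕ} (hh : 1 ≤ h) (hvd : v ∣ h - 1) (i : ℕ) :
    h ^ i = v * ((h ^ i - 1) / v) + 1 := by
  have h1 : h - 1 ∣ h ^ i - 1 := by simpa using Nat.sub_dvd_pow_sub_pow h 1 i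
  rw [Nat.mul_div_cancel' (hvd.trans h1)]
  have := Nat.one_le_pow i h hh
  omega

/-- the exponent `(1 + (v-1) h^j) / v` -/
def kap (v h j : ℕ) : ℕ := 1 + (v - 1) * ((h ^ j - 1) / v)

lemma kap_mul {v h : ℕ} (hv : 1 < v) (hh : 1 ≤ h) (hvd : v ∣ h - 1) (j : ℕ) :
    kap v h j * v = 1 + (v - 1) * h ^ j := by
  obtain ⟨u, rfl⟩ : ∃ u, v = u + 1 := ⟨v - 1, by omega⟩
  have h1 := wdef hh hvd j
  unfold kap
  set w := (h ^ j - 1) / (u + 1)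
  rw [h1]
  simp only [Nat.add_sub_cancel]
  ring

lemma kap_shift {v h : ℕ} (hv : 1 < v) (hh : 1 ≤ h) (hvd : v ∣ h - 1) {i T : ℕ} (hi : i ≤ T) :
    kap v h (T - i) * h ^ i = kap v h T + (h ^ i - 1) / v := by
  apply Nat.eq_of_mul_eq_mul_right (show 0 < v by omega)
  have h1 := kap_mul hv hh hvd (T - i)
  have h2 := kap_mul hv hh hvd T
  have h3 := wdef hh hvd i
  have h4 : h ^ T = h ^ (T - i) * h ^ i := by rw [← pow_add, Nat.sub_add_cancel hi]
  calc kap v h (T - i) * h ^ i * v = (kap v h (T - i) * v) * h ^ i := by ring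
    _ = h ^ i + (v - 1) * h ^ T := by rw [h1, h4]; ring
    _ = (v * ((h ^ i - 1) / v) + 1) + (v - 1) * h ^ T := by rw [← h3]
    _ = (kap v h T * v) + (h ^ i - 1) / v * v := by rw [h2]; ring
    _ = _ := by ring

lemma kap_split {v h : ℕ} (hv : 1 < v) (hh : 1 ≤ h) (hvd : v ∣ h - 1) {i T : ℕ} (hi : i ≤ T) :
    kap v h T = kap v h (T - i) + ((v - 1) * ((h ^ i - 1) / v)) * h ^ (T - i) := by
  apply Nat.eq_of_mul_eq_mul_right (show 0 < v by omega)
  have h1 := kap_mul hv hh hvd (T - i)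
  have h2 := kap_mul hv hh hvd T
  have h3 := wdef hh hvd i
  have h4 : h ^ T = h ^ (T - i) * h ^ i := by rw [← pow_add, Nat.sub_add_cancel hi]
  rw [add_mul, h1, h2, h4]
  calc _ = 1 + (v - 1) * (h ^ (T - i) * (v * ((h ^ i - 1) / v) + 1)) := by rw [← h3]
    _ = _ := by ring

section core
variable {F : Type*} [Field F]

/-- all the data of the bad case -/
structure Setup (p k n m v T : ℕ) (f G R : F[X]) (S : Multiset F[X]) (b : ℕ → F) : Prop where
  hv : 1 < v
  h3 : 3 ≤ p ^ k
  hvd : v ∣ p ^ k - 1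
  hf : f = S.prod * G ^ v
  f0 : f ≠ 0
  hS : ∀ P ∈ S, P ∣ R
  R0 : R ≠ 0
  b0 : b 0 = 1
  de : (X - X ^ p ^ n) * derivative f =
    (v : F[X]) * ∑ i ∈ Finset.range (m + 1), C (b i) * f ^ (((p ^ k) ^ i - 1) / v + 1)
  hT : m < T

variable {p k n m v T : ℕ} {f G R : F[X]} {S : Multiset F[X]} {b : ℕ → F}

lemma cast_h [CharP F p] (hk : k ≠ 0) : ((p ^ k : ℕ) : F[X]) = 0 := by
  have : (p : F[X]) = 0 := by exact_mod_cast CharP.cast_eq_zero F[X] p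
  rw [Nat.cast_pow, this, zero_pow hk]

lemma Setup.k0 (st : Setup p k n m v T f G R S b) : k ≠ 0 := by
  rintro rfl; have := st.h3; simp at this

lemma Setup.kv [CharP F p] (st : Setup p k n m v T f G R S b) :
    ((kap v (p ^ k) T : ℕ) : F[X]) * (v : F[X]) = 1 := by
  have h1 := kap_mul st.hv (by have := st.h3; omega) st.hvd T
  have h2 := congrArg (Nat.cast (R := F[X])) h1
  push_cast at h2
  have h3 := cast_h (F := F) (p := p) st.k0
  push_cast at h3
  have : T ≠ 0 := by have := st.hT; omega
  rw [h2, h3, zero_pow this]; simp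

lemma Setup.Yeq [CharP F p] (st : Setup p k n m v T f G R S b) :
    (X - X ^ p ^ n) * derivative (f ^ kap v (p ^ k) T) =
      ∑ i ∈ Finset.range (m + 1), C (b i) * (f ^ kap v (p ^ k) (T - i)) ^ (p ^ k) ^ i := by
  have hh : 1 ≤ p ^ k := by have := st.h3; omega
  have hk1 : kap v (p ^ k) T = (kap v (p ^ k) T - 1) + 1 := by unfold kap; omega
  rw [derivative_pow]
  calc _ = (C ((kap v (p ^ k) T : ℕ) : F)) * f ^ (kap v (p ^ k) T - 1) *
      ((X - X ^ p ^ n) * derivative f) := by ring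
    _ = (((kap v (p ^ k) T : ℕ) : F[X]) * v) * (f ^ (kap v (p ^ k) T - 1) *
      ∑ i ∈ Finset.range (m + 1), C (b i) * f ^ (((p ^ k) ^ i - 1) / v + 1)) := by
        rw [st.de]; simp only [map_natCast]; ring
    _ = _ := by
      rw [st.kv, one_mul, Finset.mul_sum]
      refine Finset.sum_congr rfl fun i hi => ?_
      have hi' : i ≤ T := by have := Finset.mem_range.1 hi; have := st.hT; omega
      rw [← pow_mul f, kap_shift st.hv hh st.hvd hi', mul_left_comm, ← pow_add]
      congr 2
      omega

lemma Setup.idA [Fact p.Prime] [CharP F p] (st : Setup p k n m v T f G R S b) (A : ℕ)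
    (hA : 0 < A) (hA2 : A < p ^ n) :
    (X - X ^ p ^ n) * (((A + 1 : ℕ) : F[X]) * hasseDeriv (A + 1) (f ^ kap v (p ^ k) T)) +
      (A : F[X]) * hasseDeriv A (f ^ kap v (p ^ k) T) =
    hasseDeriv A (f ^ kap v (p ^ k) T) + ∑ i ∈ Finset.range m, C (b (i + 1)) *
      (if (p ^ k) ^ (i + 1) ∣ A then
        (hasseDeriv (A / (p ^ k) ^ (i + 1)) (f ^ kap v (p ^ k) (T - (i + 1)))) ^ (p ^ k) ^ (i + 1)
        else 0) := by
  have h := congrArg (hasseDeriv A) st.Yeq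
  rw [hasse_XXq p n A hA hA2, hasse_deriv, hasse_deriv, Nat.sub_add_cancel hA, map_sum,
    Finset.sum_range_succ'] at h
  rw [h, add_comm]
  congr 1
  · simp [st.b0]
  · refine Finset.sum_congr rfl fun i _ => ?_
    rw [← smul_eq_C_mul, map_smul, smul_eq_C_mul, ← pow_mul p k (i + 1), hasse_pow]

lemma Setup.transfer [Fact p.Prime] [CharP F p] (st : Setup p k n m v T f G R S b) {i s : ℕ}
    (hi : i ≤ T) (hs : s < (p ^ k) ^ (T - i)) (hz : hasseDeriv s (f ^ kap v (p ^ k) T) = 0) :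
    hasseDeriv s (f ^ kap v (p ^ k) (T - i)) = 0 := by
  have hh : 1 ≤ p ^ k := by have := st.h3; omega
  rw [kap_split st.hv hh st.hvd hi, pow_add, pow_mul f, ← pow_mul p k (T - i)] at hz
  rw [← pow_mul] at hs
  rw [hasse_mul_pow p _ s hs] at hz
  rcases mul_eq_zero.1 hz with h | h
  · exact h
  · exact absurd h (pow_ne_zero _ (pow_ne_zero _ st.f0))

lemma Setup.degf (st : Setup p k n m v T f G R S b) :
    f.natDegree = S.prod.natDegree + v * G.natDegree := by
  have h0 := st.f0
  rw [st.hf] at h0 ⊢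
  rw [natDegree_mul (left_ne_zero_of_mul h0) (right_ne_zero_of_mul h0), natDegree_pow]

lemma Setup.deg [Fact p.Prime] [CharP F p] (st : Setup p k n m v T f G R S b) {s : ℕ}
    (hs : s < (p ^ k) ^ T) (hz : hasseDeriv s (f ^ kap v (p ^ k) T) ≠ 0) :
    kap v (p ^ k) T * f.natDegree ≤ s * R.natDegree +
      (hasseDeriv s (f ^ kap v (p ^ k) T)).natDegree + G.natDegree := by
  have hh : 1 ≤ p ^ k := by have := st.h3; omega
  have hkm := kap_mul st.hv hh st.hvd T
  have h0 := st.f0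
  have hdf := st.degf
  rw [st.hf] at h0
  have hS0 := left_ne_zero_of_mul h0
  have hG0 : G ≠ 0 := by
    intro h; apply right_ne_zero_of_mul h0
    rw [h, zero_pow]; have := st.hv; omega
  set κ := kap v (p ^ k) T with hκ
  have e1 : f ^ κ = (G * (κ • S).prod) * (G ^ (v - 1)) ^ p ^ (k * T) := by
    rw [st.hf, Multiset.prod_nsmul, mul_pow, ← pow_mul, mul_comm v κ, hkm, pow_mul p, pow_add,
      ← pow_mul]
    ring
  have hdv : (κ • S).prod * (G ^ (v - 1)) ^ p ^ (k * T) ∣ R ^ s * hasseDeriv s (f ^ κ) := by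
    rw [e1, hasse_mul_pow p _ s (by rwa [pow_mul]), ← mul_assoc]
    refine mul_dvd_mul_right ?_ _
    apply prod_dvd_hasse
    intro P hP
    exact st.hS P (Multiset.mem_of_mem_nsmul hP)
  have hle := natDegree_le_of_dvd hdv (mul_ne_zero (pow_ne_zero _ st.R0) hz)
  rw [natDegree_mul (pow_ne_zero _ st.R0) hz, Multiset.prod_nsmul,
    natDegree_mul (pow_ne_zero _ hS0) (pow_ne_zero _ (pow_ne_zero _ hG0)), natDegree_pow,
    natDegree_pow, natDegree_pow, natDegree_pow, pow_mul] at hle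
  rw [hdf, mul_add, ← mul_assoc, hkm]
  have : (1 + (v - 1) * (p ^ k) ^ T) * G.natDegree =
    G.natDegree + (p ^ k) ^ T * ((v - 1) * G.natDegree) := by ring
  omega

end core

lemma num1 {h v q d : ℕ} (hv : v ≤ h - 1) (h3 : 3 ≤ h) (hq : 1 ≤ q)
    (hd : d * (h * h - 1) ≤ v * (q - 1)) : (h + 1) * d < q := by
  obtain ⟨g, rfl⟩ : ∃ g, h = g + 1 := ⟨h - 1, by omega⟩
  obtain ⟨r, rfl⟩ : ∃ r, q = r + 1 := ⟨q - 1, by omega⟩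
  have e : (g + 1) * (g + 1) - 1 = g * (g + 2) := by
    have : (g + 1) * (g + 1) = g * (g + 2) + 1 := by ring
    omega
  rw [e] at hd
  simp only [Nat.add_sub_cancel] at hv hd
  have h1 : g * ((g + 1 + 1) * d) ≤ g * r := by
    calc g * ((g + 1 + 1) * d) = d * (g * (g + 2)) := by ring
      _ ≤ v * r := hd
      _ ≤ g * r := Nat.mul_le_mul_right _ hv
  have := Nat.le_of_mul_le_mul_left h1 (by omega)
  omega

lemma num2 {h v q d w A B l Gd : ℕ} (hw : v * w = h - 1) (h3 : 3 ≤ h) (hq : 1 ≤ q)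
    (hd : d * (h * h - 1) ≤ v * (q - 1)) (hg : Gd ≤ d) (hl : h ^ l * B ≤ h * d)
    (hA : h + 1 ≤ A) (hgood : (h * h - 1) * (A - 1) + 1 ≤ h ^ (l + 1)) :
    A * B + Gd + w * d < q := by
  obtain ⟨g, rfl⟩ : ∃ g, h = g + 1 := ⟨h - 1, by omega⟩
  obtain ⟨r, rfl⟩ : ∃ r, q = r + 1 := ⟨q - 1, by omega⟩
  obtain ⟨a, rfl⟩ : ∃ a, A = a + (g + 1) + 1 := ⟨A - (g + 1) - 1, by omega⟩
  have e : (g + 1) * (g + 1) - 1 = g * (g + 2) := by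
    have : (g + 1) * (g + 1) = g * (g + 2) + 1 := by ring
    omega
  rw [e] at hd hgood
  simp only [Nat.add_sub_cancel] at hw hd hgood
  have hv0 : 0 < v := by
    rcases Nat.eq_zero_or_pos v with h0 | h0
    · subst h0; omega
    · exact h0
  have hw0 : 1 ≤ w := by
    rcases Nat.eq_zero_or_pos w with h0 | h0
    · subst h0; omega
    · exact h0
  have h1 : d * w * (g + 2) ≤ r := by
    apply Nat.le_of_mul_le_mul_left _ hv0
    calc v * (d * w * (g + 2)) = d * ((v * w) * (g + 2)) := by ring
      _ = d * (g * (g + 2)) := by rw [hw]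
      _ ≤ _ := hd
  have h1' : d * (g + 2) ≤ r := by
    refine le_trans ?_ h1
    calc d * (g + 2) = d * 1 * (g + 2) := by ring
      _ ≤ _ := by gcongr
  have h2 : g * (a + (g + 1) + 1) ≤ (g + 1) ^ l := by
    apply Nat.le_of_mul_le_mul_left _ (show 0 < g + 1 by omega)
    rw [← pow_succ']
    refine le_trans ?_ hgood
    nlinarith
  have h3' : g * (a + (g + 1) + 1) * B ≤ (g + 1) * d := le_trans (Nat.mul_le_mul_right _ h2) hl
  by_contra hcon
  push Not at hcon
  have h4 : g * (g + 2) * (r + 1) ≤ g * (g + 2) * ((a + (g + 1) + 1) * B + Gd + w * d) :=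
    Nat.mul_le_mul_left _ hcon
  have h5 : g * (g + 2) * ((a + (g + 1) + 1) * B + Gd + w * d) ≤
      (g + 2) * ((g + 1) * d) + g * (g + 2) * d + g * r := by
    have i1 : (g + 2) * (g * (a + (g + 1) + 1) * B) ≤ (g + 2) * ((g + 1) * d) :=
      Nat.mul_le_mul_left _ h3'
    have i2 : g * (g + 2) * Gd ≤ g * (g + 2) * d := Nat.mul_le_mul_left _ hg
    have i3 : g * (d * w * (g + 2)) ≤ g * r := Nat.mul_le_mul_left _ h1
    nlinarith
  have h6 : (g + 2) * ((g + 1) * d) + g * (g + 2) * d ≤ (2 * g + 1) * r := by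
    calc _ = (2 * g + 1) * (d * (g + 2)) := by ring
      _ ≤ _ := Nat.mul_le_mul_left _ h1'
  have h7 : g * (g + 2) * (r + 1) ≤ (3 * g + 1) * r := by
    calc _ ≤ _ := h4.trans h5
      _ ≤ (2 * g + 1) * r + g * r := Nat.add_le_add_right h6 _
      _ = _ := by ring
  have h8 : 3 * g + 1 ≤ g * (g + 2) + 0 := by nlinarith
  have h9 : (3 * g + 1) * r ≤ g * (g + 2) * r := Nat.mul_le_mul_right _ h8
  nlinarith

lemma good_shift {h : ℕ} {A : ℕ} (i : ℕ) (hA : Good h A) : Good h (h ^ i * A) := by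
  induction i with
  | zero => simpa using hA
  | succ i ih => rw [pow_succ', mul_assoc]; exact Good.shift _ ih

section core2
variable {F : Type*} [Field F]
variable {p k n m v T : ℕ} {f G R : F[X]} {S : Multiset F[X]} {b : ℕ → F}

lemma natDegree_XXq {q : ℕ} (hq : 1 < q) : (X - X ^ q : F[X]).natDegree = q := by
  rw [natDegree_sub_eq_right_of_natDegree_lt] <;> simp [hq]

lemma XXq_ne {q : ℕ} (hq : 1 < q) : (X - X ^ q : F[X]) ≠ 0 := by
  intro h
  have := natDegree_XXq (F := F) hq
  rw [h] at this; simp at this; omega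

lemma Setup.sumzero [Fact p.Prime] [CharP F p] (st : Setup p k n m v T f G R S b) {l A : ℕ}
    (hl : l + m ≤ T) (hA : A < (p ^ k) ^ l) (i : ℕ) (hi : i < m)
    (hz : (p ^ k) ^ (i + 1) ∣ A → hasseDeriv (A / (p ^ k) ^ (i + 1)) (f ^ kap v (p ^ k) T) = 0) :
      C (b (i + 1)) *
      (if (p ^ k) ^ (i + 1) ∣ A then
        (hasseDeriv (A / (p ^ k) ^ (i + 1)) (f ^ kap v (p ^ k) (T - (i + 1)))) ^ (p ^ k) ^ (i + 1)
        else 0) = 0 := by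
  have h3 := st.h3
  split_ifs with hd
  · rw [st.transfer (by omega) _ (hz hd), zero_pow, mul_zero]
    · exact pow_ne_zero _ (by omega)
    · refine lt_of_le_of_lt (Nat.div_le_self _ _) (lt_of_lt_of_le hA ?_)
      exact Nat.pow_le_pow_right (by omega) (by omega)
  · simp

lemma Setup.claim [Fact p.Prime] [CharP F p] (st : Setup p k n m v T f G R S b) {l : ℕ}
    (hlT : l + m ≤ T) (hm : 0 < m) (hl : (p ^ k) ^ l * R.natDegree ≤ p ^ k * f.natDegree)
    (hB : 1 ≤ R.natDegree) (hd : f.natDegree * (p ^ k * p ^ k - 1) ≤ v * (p ^ n - 1)) :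
    ∀ A, A < (p ^ k) ^ l → ¬ Good (p ^ k) A → hasseDeriv A (f ^ kap v (p ^ k) T) = 0 := by
  have h3 := st.h3
  have hp : p.Prime := Fact.out
  have hph : p ∣ p ^ k := dvd_pow_self _ st.k0
  have hq0 : 1 ≤ p ^ n := Nat.one_le_pow _ _ hp.pos
  have hvh : v ≤ p ^ k - 1 := Nat.le_of_dvd (by omega) st.hvd
  have hn1 := num1 hvh h3 hq0 hd
  have hGd : G.natDegree ≤ f.natDegree := by
    rw [st.degf]
    have := Nat.mul_le_mul_right G.natDegree (show 1 ≤ v by have := st.hv; omega)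
    omega
  have hlq : (p ^ k) ^ l < p ^ n := by
    calc (p ^ k) ^ l = (p ^ k) ^ l * 1 := by ring
      _ ≤ (p ^ k) ^ l * R.natDegree := Nat.mul_le_mul_left _ hB
      _ ≤ p ^ k * f.natDegree := hl
      _ ≤ (p ^ k + 1) * f.natDegree := Nat.mul_le_mul_right _ (by omega)
      _ < _ := hn1
  have hlT' : (p ^ k) ^ l < (p ^ k) ^ T := Nat.pow_lt_pow_right (by omega) (by omega)
  have hq1 : 1 < p ^ n := by
    have := Nat.one_le_pow l (p ^ k) (by omega)
    omega
  have g1 : Good (p ^ k) 1 := by simpa using Good.one (h := p ^ k) 0 Good.zero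
  have hYd : ∀ s, (hasseDeriv s (f ^ kap v (p ^ k) T)).natDegree ≤
      kap v (p ^ k) T * f.natDegree := by
    intro s
    refine (natDegree_hasseDeriv_le _ _).trans ?_
    rw [natDegree_pow]; omega
  have castdvd : ∀ a : ℕ, p ∣ a → ((a : ℕ) : F[X]) = 0 := by
    intro a ha
    exact (CharP.cast_eq_zero_iff F[X] p a).2 ha
  have castne : ∀ a : ℕ, ¬ p ∣ a → ((a : ℕ) : F[X]) ≠ 0 := by
    intro a ha h
    exact ha ((CharP.cast_eq_zero_iff F[X] p a).1 h)
  intro A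
  induction A using Nat.strong_induction_on with
  | _ A ih =>
  intro hA hbad
  have hA2 : 2 ≤ A := by
    rcases A with _ | _ | A
    · exact absurd Good.zero hbad
    · exact absurd g1 hbad
    · omega
  by_cases hpA : p ∣ A
  · have hid := st.idA A (by omega) (by omega)
    rw [Finset.sum_eq_zero, castdvd A hpA, zero_mul, add_zero, add_zero, Nat.cast_add,
      castdvd A hpA, Nat.cast_one, zero_add, one_mul] at hid
    · by_contra hne
      have hne2 : hasseDeriv (A + 1) (f ^ kap v (p ^ k) T) ≠ 0 := by
        intro h0; rw [h0, mul_zero] at hid; exact hne hid.symm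
      have e1 := st.deg (s := A + 1) (by omega) hne2
      have e2 := hYd A
      rw [← hid, natDegree_mul (XXq_ne hq1) hne2, natDegree_XXq hq1] at e2
      have e3 : (A + 1) * R.natDegree ≤ (p ^ k) ^ l * R.natDegree := Nat.mul_le_mul_right _ hA
      have e4 : (p ^ k + 1) * f.natDegree = p ^ k * f.natDegree + f.natDegree := by ring
      omega
    · intro i hi
      refine st.sumzero hlT hA i (Finset.mem_range.1 hi) fun hdv => ?_
      have hlt : A / (p ^ k) ^ (i + 1) < A := Nat.div_lt_self (by omega)
        (Nat.one_lt_pow (by omega) (by omega))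
      refine ih _ hlt (by omega) fun hg => hbad ?_
      have := good_shift (i + 1) hg
      rwa [Nat.mul_div_cancel' hdv] at this
  · have hid := st.idA (A - 1) (by omega) (by omega)
    rw [Nat.sub_add_cancel (by omega)] at hid
    have hfin : (X - X ^ p ^ n) * ((A : F[X]) * hasseDeriv A (f ^ kap v (p ^ k) T)) = 0 →
        hasseDeriv A (f ^ kap v (p ^ k) T) = 0 := by
      intro h
      rcases mul_eq_zero.1 h with h | h
      · exact absurd h (XXq_ne hq1)
      · rcases mul_eq_zero.1 h with h | h
        · exact absurd h (castne A hpA)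
        · exact h
    by_cases hpA1 : p ∣ A - 1
    · by_cases hg : Good (p ^ k) (A - 1)
      · obtain ⟨A', hA', hAA⟩ := good_dvd hp hph hg hpA1
        have hA1 : A = p ^ k * A' + 1 := by omega
        have hndvd : ¬ p ^ k ∣ A' := by
          cases hA' with
          | zero => omega
          | shift A'' h'' =>
            exfalso; apply hbad; rw [hA1, ← mul_assoc]; exact Good.one _ h''
          | one A'' h'' =>
            intro hdv
            have : p ^ k ∣ p ^ k * p ^ k * A'' := Dvd.dvd.mul_right (Dvd.intro _ rfl) _
            have := (Nat.dvd_add_right this).1 hdv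
            have := Nat.dvd_one.1 this
            omega
        have hA0 : 1 ≤ A' := by
          rcases Nat.eq_zero_or_pos A' with h0 | h0
          · subst h0; simp at hndvd
          · exact h0
        have hAh : p ^ k + 1 ≤ A := by
          have := Nat.mul_le_mul_left (p ^ k) hA0
          omega
        have hw : v * ((p ^ k - 1) / v) = p ^ k - 1 := Nat.mul_div_cancel' st.hvd
        have hnum := num2 hw h3 hq0 hd hGd hl hAh (good_bound h3 hg l (by omega))
        by_contra hne
        have hne2 : (A : F[X]) * hasseDeriv A (f ^ kap v (p ^ k) T) ≠ 0 :=
          mul_ne_zero (castne A hpA) hne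
        have e1 := st.deg (s := A) (by omega) hne
        rw [castdvd _ hpA1, zero_mul, add_zero] at hid
        have e2 := congrArg natDegree hid
        rw [natDegree_mul (XXq_ne hq1) hne2, natDegree_XXq hq1,
          natDegree_mul (castne A hpA) hne, natDegree_natCast, zero_add] at e2
        have e3 : (∑ i ∈ Finset.range m, C (b (i + 1)) *
          (if (p ^ k) ^ (i + 1) ∣ A - 1 then
          (hasseDeriv ((A - 1) / (p ^ k) ^ (i + 1)) (f ^ kap v (p ^ k) (T - (i + 1)))) ^
            (p ^ k) ^ (i + 1) else 0)).natDegree ≤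
          kap v (p ^ k) T * f.natDegree + (p ^ k - 1) / v * f.natDegree := by
          apply natDegree_sum_le_of_forall_le
          intro i _
          refine (natDegree_C_mul_le _ _).trans ?_
          split_ifs with hdv
          · rcases i with _ | i
            · rw [natDegree_pow]
              have i1 := natDegree_hasseDeriv_le (f ^ kap v (p ^ k) (T - (0 + 1)))
                ((A - 1) / (p ^ k) ^ (0 + 1))
              rw [natDegree_pow (p := f)] at i1
              have i2 := kap_shift st.hv (by omega) st.hvd (show 0 + 1 ≤ T by omega)
              calc _ ≤ (p ^ k) ^ (0 + 1) * (kap v (p ^ k) (T - (0 + 1)) * f.natDegree) :=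
                    Nat.mul_le_mul_left _ (i1.trans (Nat.sub_le _ _))
                _ = (kap v (p ^ k) (T - (0 + 1)) * (p ^ k) ^ (0 + 1)) * f.natDegree := by ring
                _ ≤ _ := by rw [i2, add_mul, zero_add, pow_one]
            · exfalso
              rw [hAA, pow_succ'] at hdv
              have := Nat.dvd_of_mul_dvd_mul_left (by omega) hdv
              exact hndvd ((dvd_pow_self _ (by omega)).trans this)
          · simp
        have e4 := natDegree_add_le (hasseDeriv (A - 1) (f ^ kap v (p ^ k) T))
          (∑ i ∈ Finset.range m, C (b (i + 1)) *
          (if (p ^ k) ^ (i + 1) ∣ A - 1 then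
          (hasseDeriv ((A - 1) / (p ^ k) ^ (i + 1)) (f ^ kap v (p ^ k) (T - (i + 1)))) ^
            (p ^ k) ^ (i + 1) else 0))
        rw [← e2] at e4
        have e5 := hYd (A - 1)
        have e6 := e4.trans (max_le (e5.trans (Nat.le_add_right _ _)) e3)
        omega
      · apply hfin
        rw [ih (A - 1) (by omega) (by omega) hg, mul_zero, add_zero, zero_add,
          Finset.sum_eq_zero] at hid
        · exact hid
        · intro i hi
          refine st.sumzero hlT (by omega) i (Finset.mem_range.1 hi) fun hdv => ?_
          have hlt : (A - 1) / (p ^ k) ^ (i + 1) < A - 1 := Nat.div_lt_self (by omega)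
            (Nat.one_lt_pow (by omega) (by omega))
          refine ih _ (by omega) (by omega) fun hg' => hg ?_
          have := good_shift (i + 1) hg'
          rwa [Nat.mul_div_cancel' hdv] at this
    · apply hfin
      rw [Finset.sum_eq_zero, add_zero] at hid
      · by_cases hg : Good (p ^ k) (A - 1)
        · have := castdvd _ (good_not_dvd hph hg hpA1)
          have h1 : ((A - 1 : ℕ) : F[X]) = 1 := by
            have e : A - 1 = (A - 1 - 1) + 1 := by omega
            rw [e, Nat.cast_add, this]; simp
          rw [h1, one_mul] at hid
          exact add_eq_right.1 hid
        · rw [ih (A - 1) (by omega) (by omega) hg, mul_zero, add_zero] at hid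
          exact hid
      · intro i hi
        rw [if_neg, mul_zero]
        intro hdv
        exact hpA1 ((hph.trans (dvd_pow_self _ (by omega))).trans hdv)

end core2

section core3
variable {F : Type*} [Field F]
variable {p k n m v : ℕ} {f G R : F[X]} {S : Multiset F[X]} {b : ℕ → F}

lemma map_hasse_ne [Finite F] [Fact p.Prime] [CharP F p] {P J : F[X]} (hP : Irreducible P)
    (hJ : ¬ P ∣ J) (e κ x : ℕ) (hc : ¬ p ∣ (e * κ).choose x) :
    hasseDeriv x ((P ^ e * J) ^ κ) ≠ 0 := by
  intro h0
  have h1 := hasse_map (algebraMap F (AlgebraicClosure F)) x ((P ^ e * J) ^ κ)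
  rw [h0, Polynomial.map_zero] at h1
  have hdeg : (P.map (algebraMap F (AlgebraicClosure F))).degree ≠ 0 := by
    rw [degree_map]; exact hP.degree_pos.ne'
  obtain ⟨β, hβ⟩ := IsAlgClosed.exists_root _ hdeg
  obtain ⟨Q, hQ⟩ := dvd_iff_isRoot.2 hβ
  have hsep := (PerfectField.separable_of_irreducible hP).map
    (f := algebraMap F (AlgebraicClosure F))
  have hQβ : Q.eval β ≠ 0 := by
    intro hq
    obtain ⟨a, c, hac⟩ := hsep
    have := congrArg (eval β) hac
    rw [hQ] at this
    simp [hq] at this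
  have hJβ : (J.map (algebraMap F (AlgebraicClosure F))).eval β ≠ 0 := by
    intro hq
    obtain ⟨a, c, hac⟩ := (hP.coprime_iff_not_dvd.2 hJ)
    have := congrArg (fun T => eval β (T.map (algebraMap F (AlgebraicClosure F)))) hac
    simp only [Polynomial.map_add, Polynomial.map_mul, eval_add, eval_mul, hq,
      Polynomial.map_one, eval_one] at this
    rw [show (P.map (algebraMap F (AlgebraicClosure F))).eval β = 0 from hβ] at this
    simp at this
  have : CharP (AlgebraicClosure F) p := charP_of_injective_algebraMap
    (algebraMap F (AlgebraicClosure F)).injective p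
  refine hasse_ne_zero β (e * κ) x ?_ ?_
    (Q ^ (e * κ) * (J.map (algebraMap F (AlgebraicClosure F))) ^ κ) ?_ ?_
  · by_contra hlt
    rw [Nat.choose_eq_zero_of_lt (by omega)] at hc
    simp at hc
  · intro h
    exact hc ((CharP.cast_eq_zero_iff (AlgebraicClosure F) p _).1 h)
  · rw [eval_mul, eval_pow, eval_pow]
    exact mul_ne_zero (pow_ne_zero _ hQβ) (pow_ne_zero _ hJβ)
  · rw [← h1, Polynomial.map_pow, Polynomial.map_mul, Polynomial.map_pow, hQ]
    congr 1
    generalize (X - C β) = z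
    ring

theorem core_contra [Finite F] [Fact p.Prime] [CharP F p]
    (st : ∀ T, m < T → Setup p k n m v T f G R S b) (hm : 0 < m)
    (hB : 1 ≤ R.natDegree) (hd : f.natDegree * (p ^ k * p ^ k - 1) ≤ v * (p ^ n - 1))
    {P J : F[X]} (hP : Irreducible P) (hJ : ¬ P ∣ J) (e : ℕ) (hf : f = P ^ e * J)
    (hve : ¬ v ∣ e) (he : e * R.natDegree ≤ f.natDegree) : False := by
  have hp : p.Prime := Fact.out
  have st0 := st (m + 1) (by omega)
  have h3 := st0.h3
  have hv := st0.hv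
  have hvd := st0.hvd
  have he0 : e ≠ 0 := by rintro rfl; simp at hve
  have hvh : v ≤ p ^ k - 1 := Nat.le_of_dvd (by omega) hvd
  set h := p ^ k with hh
  obtain ⟨t, ht1, ht2⟩ : ∃ t, h ^ t ≤ e ∧ e < h ^ (t + 1) :=
    ⟨Nat.log h e, Nat.pow_log_le_self _ he0, Nat.lt_pow_succ_log_self (by omega) _⟩
  set l := t + 1 with hldef
  have hl : h ^ l * R.natDegree ≤ h * f.natDegree := by
    calc h ^ l * R.natDegree = h * (h ^ t * R.natDegree) := by rw [hldef]; ring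
      _ ≤ h * (e * R.natDegree) := Nat.mul_le_mul_left _ (Nat.mul_le_mul_right _ ht1)
      _ ≤ _ := Nat.mul_le_mul_left _ he
  have stT := st (l + m) (by omega)
  have claim := stT.claim le_rfl hm hl hB hd
  have hw := wdef (show 1 ≤ h by omega) hvd l
  set w := (h ^ l - 1) / v with hwd
  have hem := Nat.div_add_mod e v
  have hem0 : e % v ≠ 0 := fun h0 => hve (Nat.dvd_of_mod_eq_zero h0)
  have hemlt : e % v < v := Nat.mod_lt _ (by omega)
  obtain ⟨r, hr⟩ : ∃ r, r + e % v = v := ⟨v - e % v, by omega⟩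
  have hr0 : 1 ≤ r := by omega
  have hrv : r + 1 ≤ v := by omega
  set x := e / v + 1 + r * w with hx
  have hvx : v * x = e + r * h ^ l := by
    calc v * x = v * (e / v) + v + r * (v * w) := by rw [hx]; ring
      _ = v * (e / v) + (r + e % v) + r * (v * w) := by rw [hr]
      _ = (v * (e / v) + e % v) + r * (v * w + 1) := by ring
      _ = _ := by rw [hem, ← hw]
  have hxl : x < h ^ l := by
    apply Nat.lt_of_mul_lt_mul_left (a := v)
    rw [hvx]
    calc e + r * h ^ l < h ^ l + r * h ^ l := Nat.add_lt_add_right ht2 _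
      _ = (r + 1) * h ^ l := by ring
      _ ≤ _ := Nat.mul_le_mul_right _ hrv
  have hxbad : ¬ Good h x := by
    intro hg
    have hb := good_bound h3 hg l hxl
    have e1 : h * h - 1 = (h + 1) * (h - 1) := by
      obtain ⟨g, hg'⟩ : ∃ g, h = g + 1 := ⟨h - 1, by omega⟩
      rw [hg']
      simp only [Nat.add_sub_cancel]
      have : (g + 1) * (g + 1) = (g + 1 + 1) * g + 1 := by ring
      omega
    have e2 : h ^ l ≤ (h - 1) * x := by
      calc h ^ l ≤ e + r * h ^ l := by
            have := Nat.mul_le_mul_right (h ^ l) hr0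
            omega
        _ = v * x := hvx.symm
        _ ≤ _ := Nat.mul_le_mul_right _ hvh
    have e3 : (h + 1) * h ^ l ≤ (h * h - 1) * x := by
      rw [e1, mul_assoc]; exact Nat.mul_le_mul_left _ e2
    have e4 : (h + 1) * h ^ l = h ^ (l + 1) + h ^ l := by ring
    omega
  have hz := claim x hxl hxbad
  rw [hf] at hz
  refine map_hasse_ne hP hJ e (kap v h (l + m)) x ?_ hz
  apply choose_ne (k * l)
  · rw [pow_mul]; exact hxl
  · rw [pow_mul]
    have hcop : Nat.Coprime (h ^ l) v := by
      apply Nat.Coprime.pow_left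
      have : Nat.Coprime h (h - 1) := by
        have h1 : Nat.Coprime (h - 1 + 1) (h - 1) := by simp
        rwa [Nat.sub_add_cancel (by omega)] at h1
      exact Nat.Coprime.coprime_dvd_right hvd this
    apply Nat.ModEq.cancel_left_of_coprime hcop
    have hk := kap_mul hv (show 1 ≤ h by omega) hvd (l + m)
    have e5 : v * (e * kap v h (l + m)) = e + (e * ((v - 1) * h ^ m)) * h ^ l := by
      calc _ = e * (kap v h (l + m) * v) := by ring
        _ = _ := by rw [hk, pow_add]; ring
    rw [e5, hvx]
    have z : ∀ a : ℕ, e + a * h ^ l ≡ e [MOD h ^ l] := by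
      intro a
      simp [Nat.ModEq]
    exact (z _).trans (z _).symm

open UniqueFactorizationMonoid in
lemma factor (v : ℕ) (f : F[X]) (f0 : f ≠ 0) :
    (∃ c G, f = C c * G ^ v) ∨ ∃ (S : Multiset F[X]) (G R P J : F[X]) (e : ℕ),
      f = S.prod * G ^ v ∧ (∀ Q ∈ S, Q ∣ R) ∧ R ≠ 0 ∧ 1 ≤ R.natDegree ∧ Irreducible P ∧ ¬ P ∣ J ∧
      f = P ^ e * J ∧ ¬ v ∣ e ∧ e * R.natDegree ≤ f.natDegree := by
  classical
  set M := normalizedFactors f with hM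
  obtain ⟨u, hu⟩ := prod_normalizedFactors f0
  obtain ⟨c, hc, hcu⟩ := Polynomial.isUnit_iff.1 u.isUnit
  set N := M.toFinset with hN
  have hprod : f = C c * ∏ P ∈ N, P ^ M.count P := by
    rw [← Finset.prod_multiset_count, hcu, mul_comm]; exact hu.symm
  have hirr : ∀ P ∈ N, Irreducible P := fun P hP =>
    irreducible_of_normalized_factor P (Multiset.mem_toFinset.1 hP)
  set G := ∏ P ∈ N, P ^ (M.count P / v) with hG
  have hsplit : f = (C c * ∏ P ∈ N, P ^ (M.count P % v)) * G ^ v := by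
    rw [hG, mul_assoc, ← Finset.prod_pow, ← Finset.prod_mul_distrib, hprod]
    congr 1
    refine Finset.prod_congr rfl fun P _ => ?_
    rw [← pow_mul, ← pow_add, mul_comm, Nat.mod_add_div]
  set bad := N.filter (fun P => ¬ v ∣ M.count P) with hbad
  rcases bad.eq_empty_or_nonempty with hemp | hne
  · left
    refine ⟨c, G, ?_⟩
    rw [hsplit, Finset.prod_eq_one, mul_one]
    intro P hP
    have : v ∣ M.count P := by
      by_contra h
      have : P ∈ bad := Finset.mem_filter.2 ⟨hP, h⟩
      rw [hemp] at this; simp at this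
    rw [Nat.mod_eq_zero_of_dvd this, pow_zero]
  · right
    obtain ⟨P, hPb, hPmin⟩ := Finset.exists_min_image bad (fun P => M.count P) hne
    obtain ⟨hPN, hPv⟩ := Finset.mem_filter.1 hPb
    have hR0 : ∏ Q ∈ bad, Q ≠ 0 := Finset.prod_ne_zero_iff.2 fun Q hQ =>
      (hirr Q (Finset.mem_filter.1 hQ).1).ne_zero
    have hmult : emultiplicity P f = M.count P := by
      rw [emultiplicity_eq_count_normalizedFactors (hirr P hPN) f0,
        normalize_normalized_factor P (Multiset.mem_toFinset.1 hPN)]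
    have hfin : FiniteMultiplicity P f := by
      rw [finiteMultiplicity_iff_emultiplicity_ne_top, hmult]; simp
    obtain ⟨J, hJ1, hJ2⟩ := hfin.exists_eq_pow_mul_and_not_dvd
    rw [multiplicity_eq_of_emultiplicity_eq_some hmult] at hJ1
    refine ⟨C c ::ₘ ∑ P ∈ N, (M.count P % v) • ({P} : Multiset F[X]), G, ∏ Q ∈ bad, Q, P, J,
      M.count P, ?_, ?_, hR0, ?_, hirr P hPN, hJ2, hJ1, hPv, ?_⟩
    · rw [Multiset.prod_cons, Multiset.prod_sum]
      simp only [Multiset.prod_nsmul, Multiset.prod_singleton]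
      exact hsplit
    · intro Q hQ
      rcases Multiset.mem_cons.1 hQ with rfl | hQ
      · exact (isUnit_C.2 hc).dvd
      · obtain ⟨Q', hQ', hQm⟩ := Multiset.mem_sum.1 hQ
        have hQQ : Q = Q' := by
          have := Multiset.mem_of_mem_nsmul hQm
          simpa using this
        subst hQQ
        apply Finset.dvd_prod_of_mem
        refine Finset.mem_filter.2 ⟨hQ', fun hdv => ?_⟩
        rw [Nat.mod_eq_zero_of_dvd hdv] at hQm
        simp at hQm
    · have := natDegree_le_of_dvd (Finset.dvd_prod_of_mem (fun Q => Q) hPb) hR0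
      exact le_trans (hirr P hPN).natDegree_pos this
    · rw [← natDegree_pow]
      apply natDegree_le_of_dvd _ f0
      rw [hprod, ← Finset.prod_pow]
      apply Dvd.dvd.mul_left
      refine dvd_trans ?_ (Finset.prod_dvd_prod_of_subset bad N _ (Finset.filter_subset _ _))
      exact Finset.prod_dvd_prod_of_dvd _ _ fun Q hQ => pow_dvd_pow _ (hPmin Q hQ)

end core3

section fin
set_option linter.unusedSectionVars false
variable {F : Type} [Field F] [Fintype F] [DecidableEq F]

lemma splits_q : (X ^ Fintype.card F - X : F[X]).Splits := by
  rw [splits_iff_card_roots, FiniteField.roots_X_pow_card_sub_X,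
    FiniteField.X_pow_card_sub_X_natDegree_eq F Fintype.one_lt_card]
  rfl

lemma card_fix {p n k : ℕ} [Fact p.Prime] [CharP F p] (hk : k ∣ n) (hk0 : k ≠ 0)
    (hcard : Fintype.card F = p ^ n) :
    (Finset.univ.filter (fun c : F => c ^ p ^ k = c)).card = p ^ k := by
  have hp : p.Prime := Fact.out
  have h1 : 1 < p ^ k := Nat.one_lt_pow hk0 hp.one_lt
  have hdv : (X ^ p ^ k - X : F[X]) ∣ X ^ Fintype.card F - X := by
    rw [hcard]; exact dvd_pow_pow_sub_self_of_dvd hk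
  have hne : (X ^ p ^ k - X : F[X]) ≠ 0 := FiniteField.X_pow_card_sub_X_ne_zero F h1
  have hsp : (X ^ p ^ k - X : F[X]).Splits := by
    exact Splits.of_dvd splits_q (FiniteField.X_pow_card_sub_X_ne_zero F Fintype.one_lt_card) hdv
  have hnd : (X ^ p ^ k - X : F[X]).roots.Nodup :=
    nodup_roots (galois_poly_separable p (p ^ k) (dvd_pow_self _ hk0))
  have hc := hsp.natDegree_eq_card_roots
  rw [FiniteField.X_pow_card_sub_X_natDegree_eq F h1] at hc
  refine Eq.trans ?_ hc.symm
  rw [← Multiset.toFinset_card_of_nodup hnd]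
  congr 1
  ext c
  simp [hne, sub_eq_zero]

lemma exists_L {p n k m : ℕ} [Fact p.Prime] [CharP F p] (hk : k ∣ n) (hk0 : k ≠ 0)
    (hcard : Fintype.card F = p ^ n) (U : Finset F) (hU : IsSubspaceOver (p ^ k) (↑U : Set F))
    (hUcard : U.card = (p ^ k) ^ m) :
    ∃ a : ℕ → F, a 0 ≠ 0 ∧ ∀ u ∈ U, ∑ i ∈ Finset.range (m + 1), a i * u ^ (p ^ k) ^ i = 0 := by
  have hp : p.Prime := Fact.out
  have h1 : 1 < p ^ k := Nat.one_lt_pow hk0 hp.one_lt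
  obtain ⟨hU0, hUadd, hUneg, hUsmul⟩ := hU
  let K : Subfield F := RingHom.eqLocusField (iterateFrobenius F p k) (RingHom.id F)
  have hK : ∀ c : F, c ∈ K ↔ c ^ p ^ k = c := by
    intro c
    simp [K, RingHom.mem_eqLocusField, iterateFrobenius_def]
  have hKcard : Nat.card K = p ^ k := by
    rw [← card_fix (F := F) hk hk0 hcard, ← Nat.card_eq_finsetCard]
    apply Nat.card_congr
    refine Equiv.subtypeEquivRight fun c => ?_
    simp [hK]
  let W : Submodule K F :=
    { carrier := ↑U
      add_mem' := fun {x y} hx hy => hUadd x hx y hy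
      zero_mem' := hU0
      smul_mem' := fun c x hx => hUsmul c ((hK c).1 c.2) x hx }
  have hWcard : Nat.card W = (p ^ k) ^ m := by
    rw [← hUcard, ← Nat.card_eq_finsetCard]
    exact Nat.card_congr (Equiv.subtypeEquivRight fun c => Iff.rfl)
  have hfr : Module.finrank K W = m := by
    have := Module.natCard_eq_pow_finrank (K := K) (V := W)
    rw [hWcard, hKcard] at this
    exact (Nat.pow_right_injective h1 this).symm
  let B : Module.Basis (Fin m) K W := (Module.finBasis K W).reindex (finCongr hfr)
  let φ : (Fin (m + 1) → F) →ₗ[F] (Fin m → F) :=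
    { toFun := fun a j => ∑ i, a i * (B j : F) ^ (p ^ k) ^ (i : ℕ)
      map_add' := by
        intro x y; funext j
        simp [add_mul, Finset.sum_add_distrib]
      map_smul' := by
        intro c x; funext j
        simp [Finset.mul_sum, mul_assoc] }
  have hker : LinearMap.ker φ ≠ ⊥ := LinearMap.ker_ne_bot_of_finrank_lt (by simp)
  obtain ⟨a', ha', hane⟩ := (Submodule.ne_bot_iff _).1 hker
  have hB : ∀ j, ∑ i, a' i * (B j : F) ^ (p ^ k) ^ (i : ℕ) = 0 := by
    intro j
    exact congrFun (LinearMap.mem_ker.1 ha') j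
  have hKpow : ∀ c : K, ∀ i : ℕ, (c : F) ^ (p ^ k) ^ i = c := by
    intro c i
    induction i with
    | zero => simp
    | succ i ih => rw [pow_succ, pow_mul, ih]; exact (hK c).1 c.2
  have hall : ∀ u ∈ U, ∑ i, a' i * u ^ (p ^ k) ^ (i : ℕ) = 0 := by
    intro u hu
    have hrep := congrArg (Subtype.val) (B.sum_repr ⟨u, hu⟩)
    simp only [AddSubmonoidClass.coe_finsetSum, Submodule.coe_smul] at hrep
    have hpow : ∀ i : ℕ, u ^ (p ^ k) ^ i =
        ∑ j, (B.repr ⟨u, hu⟩ j : F) * (B j : F) ^ (p ^ k) ^ i := by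
      intro i
      conv_lhs => rw [← hrep]
      rw [← pow_mul, sum_pow_char_pow]
      refine Finset.sum_congr rfl fun j _ => ?_
      rw [Subfield.smul_def, smul_eq_mul, mul_pow, pow_mul, hKpow]
    simp_rw [hpow, Finset.mul_sum]
    rw [Finset.sum_comm]
    refine Finset.sum_eq_zero fun j _ => ?_
    have := congrArg (fun t => (B.repr ⟨u, hu⟩ j : F) * t) (hB j)
    simp only [Finset.mul_sum, mul_zero] at this
    rw [← this]
    refine Finset.sum_congr rfl fun i _ => ?_
    ring
  let a : ℕ → F := fun i => if hi : i < m + 1 then a' ⟨i, hi⟩ else 0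
  have ha : ∀ i : Fin (m + 1), a i = a' i := fun i => dif_pos i.2
  have haU : ∀ u ∈ U, ∑ i ∈ Finset.range (m + 1), a i * u ^ (p ^ k) ^ i = 0 := by
    intro u hu
    rw [Finset.sum_range, ← hall u hu]
    simp only [ha]
  refine ⟨a, fun ha0 => hane ?_, haU⟩
  have hL : (∑ i ∈ Finset.range (m + 1), C (a i) * X ^ ((p ^ k) ^ i - 1) : F[X]) = 0 := by
    apply eq_zero_of_natDegree_lt_card_of_eval_eq_zero' _ U
    · intro u hu
      rw [eval_finsetSum]
      by_cases hu0 : u = 0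
      · subst hu0
        refine Finset.sum_eq_zero fun i _ => ?_
        rcases i with _ | i
        · simp [ha0]
        · have : (p ^ k) ^ (i + 1) - 1 ≠ 0 := by
            have := Nat.one_lt_pow (n := i + 1) (by omega) h1
            omega
          simp [this]
      · refine (mul_eq_zero.1 (?_ : u * _ = 0)).resolve_left hu0
        rw [Finset.mul_sum, ← haU u hu]
        refine Finset.sum_congr rfl fun i _ => ?_
        have : 1 ≤ (p ^ k) ^ i := Nat.one_le_pow _ _ (by omega)
        obtain ⟨t, ht⟩ : ∃ t, (p ^ k) ^ i = t + 1 := ⟨(p ^ k) ^ i - 1, by omega⟩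
        simp only [ht, eval_mul, eval_C, eval_pow, eval_X, Nat.add_sub_cancel]
        ring
    · rw [hUcard]
      have h2 : 1 ≤ (p ^ k) ^ m := Nat.one_le_pow _ _ (by omega)
      refine lt_of_le_of_lt (b := (p ^ k) ^ m - 1) ?_ (by omega)
      apply natDegree_sum_le_of_forall_le
      intro i hi
      refine (natDegree_C_mul_X_pow_le _ _).trans ?_
      have : (p ^ k) ^ i ≤ (p ^ k) ^ m :=
        Nat.pow_le_pow_right (by omega) (by have := Finset.mem_range.1 hi; omega)
      omega
  funext j
  have := congrArg (fun P => coeff P ((p ^ k) ^ (j : ℕ) - 1)) hL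
  simp only [finsetSum_coeff, coeff_C_mul, coeff_X_pow, coeff_zero] at this
  rw [Finset.sum_eq_single (j : ℕ)] at this
  · simpa [ha] using this
  · intro i _ hij
    rw [if_neg, mul_zero]
    intro heq
    have i1 : 1 ≤ (p ^ k) ^ i := Nat.one_le_pow _ _ (by omega)
    have i2 : 1 ≤ (p ^ k) ^ (j : ℕ) := Nat.one_le_pow _ _ (by omega)
    exact hij (Nat.pow_right_injective h1 (show (p ^ k) ^ i = (p ^ k) ^ (j : ℕ) by omega))
  · intro h
    exact absurd (Finset.mem_range.2 j.2) h

lemma XqX_dvd (P : F[X]) (hP : ∀ x, P.eval x = 0) : (X ^ Fintype.card F - X : F[X]) ∣ P := by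
  by_cases h0 : P = 0
  · subst h0; exact dvd_zero _
  refine splits_q.dvd_of_roots_le_roots (FiniteField.X_pow_card_sub_X_ne_zero F Fintype.one_lt_card) ?_
  rw [FiniteField.roots_X_pow_card_sub_X]
  refine (Multiset.le_iff_subset Finset.univ.nodup).2 fun x _ => ?_
  rw [mem_roots h0]
  exact hP x

lemma der_aux {p k m v : ℕ} [Fact p.Prime] [CharP F p] (hk0 : k ≠ 0) (hv : 1 < v)
    (hvd : v ∣ p ^ k - 1) (a : ℕ → F) (f : F[X]) :
    (v : F[X]) * (f * derivative (∑ i ∈ Finset.range (m + 1),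
      C (a i) * f ^ (((p ^ k) ^ i - 1) / v + 1))) =
      ((v : F[X]) - 1) * ((∑ i ∈ Finset.range (m + 1),
      C (a i) * f ^ (((p ^ k) ^ i - 1) / v + 1)) * derivative f) + C (a 0) * f * derivative f := by
  have hp : p.Prime := Fact.out
  have h1 : 1 < p ^ k := Nat.one_lt_pow hk0 hp.one_lt
  have hcastp : (p : F[X]) = 0 := by exact_mod_cast CharP.cast_eq_zero F[X] p
  have key : ∀ i, (v : F[X]) * (f * derivative (C (a (i + 1)) *
      f ^ (((p ^ k) ^ (i + 1) - 1) / v + 1))) =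
      ((v : F[X]) - 1) * ((C (a (i + 1)) * f ^ (((p ^ k) ^ (i + 1) - 1) / v + 1)) *
        derivative f) := by
    intro i
    have hw := wdef h1.le hvd (i + 1)
    generalize ((p ^ k) ^ (i + 1) - 1) / v = w at hw ⊢
    have hw2 := congrArg (Nat.cast (R := F[X])) hw
    rw [Nat.cast_pow, Nat.cast_pow, hcastp, zero_pow hk0, zero_pow (by omega), Nat.cast_add,
      Nat.cast_mul, Nat.cast_one] at hw2
    rw [derivative_C_mul, derivative_pow, Nat.add_sub_cancel, map_natCast, Nat.cast_add,
      Nat.cast_one]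
    generalize C (a (i + 1)) = c
    generalize derivative f = g
    have hv2 : (v : F[X]) * (w : F[X]) = -1 := by linear_combination -hw2
    linear_combination (c * f ^ (w + 1) * g) * hv2
  have e0 : (v : F[X]) * (f * derivative (C (a 0) * f ^ (((p ^ k) ^ 0 - 1) / v + 1))) =
      ((v : F[X]) - 1) * (C (a 0) * f ^ (((p ^ k) ^ 0 - 1) / v + 1) * derivative f) +
        C (a 0) * f * derivative f := by
    simp only [pow_zero, Nat.sub_self, Nat.zero_div, zero_add, pow_one, derivative_C_mul]
    ring
  rw [derivative_sum, Finset.sum_mul, Finset.mul_sum, Finset.mul_sum, Finset.mul_sum,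
    Finset.sum_range_succ', Finset.sum_range_succ' (n := m), e0, ← add_assoc]
  congr 2
  exact Finset.sum_congr rfl fun i _ => key i

lemma diffeq {p n k m v : ℕ} [Fact p.Prime] [CharP F p] (hk0 : k ≠ 0) (hn : n ≠ 0) (hv : 1 < v)
    (hvd : v ∣ p ^ k - 1)
    (hcard : Fintype.card F = p ^ n) (U : Finset F) (a : ℕ → F) (ha0 : a 0 ≠ 0)
    (haU : ∀ u ∈ U, ∑ i ∈ Finset.range (m + 1), a i * u ^ (p ^ k) ^ i = 0)
    (f : F[X]) (hf : ∀ x, ∃ u ∈ U, f.eval x = u ^ v)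
    (hd0 : 0 < f.natDegree)
    (hds : f.natDegree * (((p ^ k) ^ m - 1) / v) ≤ p ^ n - 1) (hd2 : 2 * f.natDegree ≤ p ^ n) :
    (X - X ^ p ^ n) * derivative f =
    (v : F[X]) * ∑ i ∈ Finset.range (m + 1), C (a i / a 0) * f ^ (((p ^ k) ^ i - 1) / v + 1) := by
  have hp : p.Prime := Fact.out
  have h1 : 1 < p ^ k := Nat.one_lt_pow hk0 hp.one_lt
  have hq1 : 1 < p ^ n := Nat.one_lt_pow hn hp.one_lt
  set Tf : F[X] := ∑ i ∈ Finset.range (m + 1), C (a i) * f ^ (((p ^ k) ^ i - 1) / v + 1) with hTf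
  have f0 : f ≠ 0 := by rintro rfl; simp at hd0
  have hTdv : (X ^ p ^ n - X : F[X]) ∣ Tf := by
    rw [← hcard]
    apply XqX_dvd
    intro x
    obtain ⟨u, hu, hux⟩ := hf x
    rw [hTf, eval_finsetSum]
    have hv1 : v = (v - 1) + 1 := by omega
    calc _ = ∑ i ∈ Finset.range (m + 1), u ^ (v - 1) * (a i * u ^ (p ^ k) ^ i) := by
          refine Finset.sum_congr rfl fun i _ => ?_
          have hw := wdef h1.le hvd i
          rw [eval_mul, eval_C, eval_pow, hux, ← pow_mul, mul_add, mul_one, mul_left_comm,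
            ← pow_add]
          congr 2
          omega
      _ = 0 := by rw [← Finset.mul_sum, haU u hu, mul_zero]
  obtain ⟨G, hG⟩ := hTdv
  have hXne : (X ^ p ^ n - X : F[X]) ≠ 0 := FiniteField.X_pow_card_sub_X_ne_zero F hq1
  have hXdeg : (X ^ p ^ n - X : F[X]).natDegree = p ^ n :=
    FiniteField.X_pow_card_sub_X_natDegree_eq F hq1
  have hGdeg : G.natDegree + 1 ≤ f.natDegree := by
    by_cases hG0 : G = 0
    · rw [hG0, natDegree_zero]; omega
    have e1 : Tf.natDegree ≤ f.natDegree * (((p ^ k) ^ m - 1) / v) + f.natDegree := by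
      apply natDegree_sum_le_of_forall_le
      intro i hi
      refine (natDegree_C_mul_le _ _).trans ?_
      rw [natDegree_pow, add_mul, one_mul, mul_comm f.natDegree]
      have : (p ^ k) ^ i ≤ (p ^ k) ^ m :=
        Nat.pow_le_pow_right (by omega) (by have := Finset.mem_range.1 hi; omega)
      have := Nat.div_le_div_right (c := v) (Nat.sub_le_sub_right this 1)
      exact Nat.add_le_add_right (Nat.mul_le_mul_right _ this) _
    rw [hG, natDegree_mul hXne hG0, hXdeg] at e1
    omega
  have hcastp : (p : F[X]) = 0 := by exact_mod_cast CharP.cast_eq_zero F[X] p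
  have hder := der_aux (m := m) hk0 hv hvd a f
  rw [← hTf] at hder
  have hderT : derivative Tf = - G + (X ^ p ^ n - X) * derivative G := by
    rw [hG, derivative_mul, derivative_sub, derivative_X_pow, derivative_X]
    simp only [map_natCast]
    push_cast
    rw [hcastp, zero_pow hn]; ring
  have hdv2 : (X ^ p ^ n - X : F[X]) ∣ f * (C (a 0) * derivative f + (v : F[X]) * G) := by
    refine ⟨(v : F[X]) * f * derivative G - ((v : F[X]) - 1) * G * derivative f, ?_⟩
    rw [hderT, hG] at hder
    linear_combination -hder
  have hz : f * (C (a 0) * derivative f + (v : F[X]) * G) = 0 := by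
    apply eq_zero_of_dvd_of_natDegree_lt hdv2
    rw [hXdeg]
    refine lt_of_le_of_lt natDegree_mul_le ?_
    have e1 : (C (a 0) * derivative f).natDegree ≤ f.natDegree - 1 :=
      (natDegree_C_mul_le _ _).trans (natDegree_derivative_le _)
    have e2 : ((v : F[X]) * G).natDegree ≤ f.natDegree - 1 := by
      refine natDegree_mul_le.trans ?_
      rw [natDegree_natCast]; omega
    have e3 := (natDegree_add_le (C (a 0) * derivative f) ((v : F[X]) * G)).trans (max_le e1 e2)
    omega
  have hz2 := (mul_eq_zero.1 hz).resolve_left f0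
  have hfin : C (a 0) * ((X - X ^ p ^ n) * derivative f) = (v : F[X]) * Tf := by
    rw [hG]
    linear_combination (X - X ^ p ^ n) * hz2
  have hCa : (C (a 0)⁻¹ : F[X]) * C (a 0) = 1 := by rw [← C_mul, inv_mul_cancel₀ ha0, C_1]
  have e5 : ∑ i ∈ Finset.range (m + 1), C (a i / a 0) * f ^ (((p ^ k) ^ i - 1) / v + 1) =
      C (a 0)⁻¹ * Tf := by
    rw [hTf, Finset.mul_sum]
    refine Finset.sum_congr rfl fun i _ => ?_
    rw [← mul_assoc, ← C_mul, div_eq_inv_mul]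
  rw [e5]
  linear_combination (C (a 0)⁻¹) * hfin - ((X - X ^ p ^ n) * derivative f) * hCa

end fin

section final
variable {F : Type} [Field F] [Fintype F] [DecidableEq F]

lemma count_aux (U : Finset F) (v : ℕ) (hv : 1 < v) (h0 : (0 : F) ∈ U) :
    U.card - 1 ≤ v * ((U.image (fun u => u ^ v)).card - 1) := by
  have h1 : (U.erase 0).card ≤ v * ((U.erase 0).image (fun u => u ^ v)).card := by
    apply Finset.card_le_mul_card_image
    intro a _
    refine le_trans (Finset.card_le_card (t := (nthRoots v a).toFinset) ?_)
      ((Multiset.toFinset_card_le _).trans (card_nthRoots v a))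
    intro x hx
    rw [Multiset.mem_toFinset, mem_nthRoots (by omega)]
    exact (Finset.mem_filter.1 hx).2
  rw [Finset.card_erase_of_mem h0] at h1
  refine h1.trans (Nat.mul_le_mul_left _ ?_)
  have h0' : (0 : F) ∈ U.image (fun u => u ^ v) :=
    Finset.mem_image.2 ⟨0, h0, zero_pow (by omega)⟩
  rw [← Finset.card_erase_of_mem h0']
  apply Finset.card_le_card
  intro y hy
  obtain ⟨x, hx, rfl⟩ := Finset.mem_image.1 hy
  obtain ⟨hx0, hxU⟩ := Finset.mem_erase.1 hx
  exact Finset.mem_erase.2 ⟨pow_ne_zero _ hx0, Finset.mem_image.2 ⟨x, hxU, rfl⟩⟩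

lemma power_case {h v : ℕ} (hv : 1 < v) (h1 : 1 ≤ h) (hvd : v ∣ h - 1)
    (U : Finset F) (hU : IsSubspaceOver h (↑U : Set F)) (hone : (1 : F) ∈ U)
    (f : F[X]) (hf : f ∈ MVSPset (U.image (fun u => u ^ v)))
    (c : F) (G : F[X]) (hfG : f = C c * G ^ v) : ∃ g ∈ MVSPset U, f = g ^ v := by
  obtain ⟨⟨hd0, hcardV⟩, hV⟩ := hf
  have hval : ∀ x, ∃ u ∈ U, u ^ v = f.eval x := by
    intro x
    have : f.eval x ∈ valueSet f := Finset.mem_image.2 ⟨x, Finset.mem_univ _, rfl⟩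
    rw [hV] at this
    exact Finset.mem_image.1 this
  have h1mem : (1 : F) ∈ valueSet f := by
    rw [hV]; exact Finset.mem_image.2 ⟨1, hone, one_pow _⟩
  obtain ⟨x0, _, hx0⟩ := Finset.mem_image.1 h1mem
  have hx0 : c * (G.eval x0) ^ v = 1 := by simpa [hfG] using hx0
  have hG0 : G.eval x0 ≠ 0 := by
    intro h; rw [h, zero_pow (by omega), mul_zero] at hx0; exact zero_ne_one hx0
  set g : F[X] := C (G.eval x0)⁻¹ * G with hg
  have hfg : f = g ^ v := by
    rw [hg, mul_pow, ← C_pow, hfG, inv_pow, eq_inv_of_mul_eq_one_left hx0]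
  have hdeg : f.natDegree = v * g.natDegree := by rw [hfg, natDegree_pow]
  have hδ : 0 < g.natDegree := by
    rcases Nat.eq_zero_or_pos g.natDegree with h | h
    · rw [h] at hdeg; omega
    · exact h
  refine ⟨g, ?_, hfg⟩
  have hsub : valueSet g ⊆ U := by
    intro y hy
    obtain ⟨x, _, rfl⟩ := Finset.mem_image.1 hy
    obtain ⟨u, hu, hux⟩ := hval x
    rw [hfg, eval_pow] at hux
    by_cases hu0 : u = 0
    · rw [hu0, zero_pow (by omega)] at hux
      have : g.eval x = 0 := pow_eq_zero_iff (by omega) |>.1 hux.symm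
      rw [this]; exact hU.1
    · have hz : (g.eval x / u) ^ v = 1 := by
        rw [div_pow, ← hux, div_self (pow_ne_zero _ hu0)]
      have hz2 : (g.eval x / u) ^ h = g.eval x / u := by
        obtain ⟨t, ht⟩ := hvd
        have : h = v * t + 1 := by omega
        rw [this, pow_succ, pow_mul, hz, one_pow, one_mul]
      have := hU.2.2.2 _ hz2 u hu
      rw [div_mul_cancel₀ _ hu0] at this
      exact this
  have hq : Fintype.card F ≤ g.natDegree * (valueSet g).card := by
    have := FiniteField.card_image_polynomial_eval (R := F) (p := g)
      (natDegree_pos_iff_degree_pos.1 hδ)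
    exact this
  have hcnt := count_aux U v hv hU.1
  rw [← hV, hcardV, hdeg, Nat.add_sub_cancel] at hcnt
  have hqpos : 1 < Fintype.card F := Fintype.one_lt_card
  have hUpos : 0 < U.card := Finset.card_pos.2 ⟨1, hone⟩
  have e1 : v * ((Fintype.card F - 1) / (v * g.natDegree)) ≤ (Fintype.card F - 1) / g.natDegree := by
    rw [Nat.le_div_iff_mul_le hδ]
    calc _ = ((Fintype.card F - 1) / (v * g.natDegree)) * (v * g.natDegree) := by ring
      _ ≤ _ := Nat.div_mul_le_self _ _
  have e2 : (Fintype.card F - 1) / g.natDegree < (valueSet g).card := by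
    rw [Nat.div_lt_iff_lt_mul hδ, mul_comm]; omega
  have e3 := Finset.card_le_card hsub
  have heq : valueSet g = U := Finset.eq_of_subset_of_card_le hsub (by omega)
  exact ⟨⟨hδ, by rw [heq] at e2 ⊢; omega⟩, heq⟩

lemma m_gt {p n k m : ℕ} [Fact p.Prime] [CharP F p] (hk : k ∣ n) (hk0 : k ≠ 0)
    (hcard : Fintype.card F = p ^ n) (U : Finset F) (hU : IsSubspaceOver (p ^ k) (↑U : Set F))
    (hone : (1 : F) ∈ U) (hUcard : U.card = p ^ (m * k))
    (hUne : U ≠ Finset.univ.filter (fun c : F => c ^ p ^ (m * k) = c)) : 1 < m := by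
  by_contra hm
  obtain rfl | rfl : m = 0 ∨ m = 1 := by omega
  · rw [zero_mul, pow_zero] at hUcard
    have := Finset.card_le_one.1 hUcard.le 0 hU.1 1 hone
    exact zero_ne_one this
  · rw [one_mul] at hUcard hUne
    apply hUne
    symm
    apply Finset.eq_of_subset_of_card_le
    · intro c hc
      have := hU.2.2.2 c (Finset.mem_filter.1 hc).2 1 hone
      simpa using this
    · rw [hUcard, card_fix hk hk0 hcard]

theorem main {p n k v m : ℕ} [Fact p.Prime] [CharP F p] (hn : n ≠ 0) (hk : k ∣ n) (hk0 : k ≠ 0)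
    (hv : 1 < v) (hvd : v ∣ p ^ k - 1) (hcard : Fintype.card F = p ^ n)
    (U : Finset F) (hU : IsSubspaceOver (p ^ k) (↑U : Set F)) (hone : (1 : F) ∈ U)
    (hUcard : U.card = (p ^ k) ^ m) (hm : 1 < m)
    (f : F[X]) (hf : f ∈ MVSPset (U.image (fun u => u ^ v))) : ∃ g ∈ MVSPset U, f = g ^ v := by
  have hp : p.Prime := Fact.out
  have h1 : 1 < p ^ k := Nat.one_lt_pow hk0 hp.one_lt
  have hvh : v ≤ p ^ k - 1 := Nat.le_of_dvd (by omega) hvd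
  have h3 : 3 ≤ p ^ k := by omega
  have hf' := hf
  obtain ⟨⟨hd0, hcardV⟩, hV⟩ := hf'
  have hcnt := count_aux U v hv hU.1
  rw [← hV, hcardV, Nat.add_sub_cancel, hUcard, hcard] at hcnt
  have hN := Nat.div_mul_le_self (p ^ n - 1) f.natDegree
  generalize (p ^ n - 1) / f.natDegree = N at hcnt hN
  have f0 : f ≠ 0 := by rintro rfl; simp at hd0
  have hd : f.natDegree * (p ^ k * p ^ k - 1) ≤ v * (p ^ n - 1) := by
    have i1 : p ^ k * p ^ k ≤ (p ^ k) ^ m := by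
      rw [← pow_two]; exact Nat.pow_le_pow_right (by omega) hm
    calc f.natDegree * (p ^ k * p ^ k - 1) ≤ f.natDegree * ((p ^ k) ^ m - 1) :=
          Nat.mul_le_mul_left _ (Nat.sub_le_sub_right i1 1)
      _ ≤ f.natDegree * (v * N) := Nat.mul_le_mul_left _ hcnt
      _ = v * (N * f.natDegree) := by ring
      _ ≤ _ := Nat.mul_le_mul_left _ hN
  have hds : f.natDegree * (((p ^ k) ^ m - 1) / v) ≤ p ^ n - 1 := by
    refine le_trans ?_ hN
    rw [mul_comm]
    apply Nat.mul_le_mul_right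
    calc ((p ^ k) ^ m - 1) / v ≤ (v * N) / v := Nat.div_le_div_right hcnt
      _ = N := Nat.mul_div_cancel_left _ (by omega)
  have hd2 : 2 * f.natDegree ≤ p ^ n := by
    have i1 := num1 hvh h3 (Nat.one_le_pow _ _ hp.pos) hd
    have i2 : 2 * f.natDegree ≤ (p ^ k + 1) * f.natDegree := Nat.mul_le_mul_right _ (by omega)
    omega
  rcases factor v f f0 with ⟨c, G, hcG⟩ | ⟨S, G, R, P, J, e, hfS, hS, hR0, hB, hP, hJ, hfJ, hve, he⟩
  · exact power_case hv h1.le hvd U hU hone f hf c G hcG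
  · exfalso
    obtain ⟨a, ha0, haU⟩ := exists_L hk hk0 hcard U hU hUcard
    have hval : ∀ x, ∃ u ∈ U, f.eval x = u ^ v := by
      intro x
      have : f.eval x ∈ valueSet f := Finset.mem_image.2 ⟨x, Finset.mem_univ _, rfl⟩
      rw [hV] at this
      obtain ⟨u, hu, hux⟩ := Finset.mem_image.1 this
      exact ⟨u, hu, hux.symm⟩
    have hde := diffeq hk0 hn hv hvd hcard U a ha0 haU f hval hd0 hds hd2
    refine core_contra (p := p) (k := k) (n := n) (m := m) (v := v) (f := f) (G := G) (R := R)
      (S := S) (b := fun i => a i / a 0) ?_ (by omega) hB hd hP hJ e hfJ hve he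
    intro T hT
    exact ⟨hv, h3, hvd, hfS, f0, hS, hR0, div_self ha0, hde, hT⟩

end final

end MV

/-- if `U ≠ 𝔽_{p^{mk}}` then `m > 1` and every `F ∈ 𝒫(U^v, q)` not of the form
`f^v` with `f ∈ 𝒫(U, q)` satisfies `deg F > (√(p^n) + 1) · p^{mk}`. -/
theorem stmt_3 (p n k v m : ℕ) (hp : p.Prime) (hn : 0 < n) (hk : k ∣ n)
    (hv : 1 < v) (hvd : v ∣ p ^ k - 1)
    (F : Type) [Field F] [Fintype F] [DecidableEq F]
    (hcard : Fintype.card F = p ^ n)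
    (U : Finset F) (hU : IsSubspaceOver (p ^ k) (↑U : Set F)) (h1 : (1 : F) ∈ U)
    (hUcard : U.card = p ^ (m * k))
    (hUv : 2 < (U.image (fun u => u ^ v)).card)
    (hUne : U ≠ Finset.univ.filter (fun c : F => c ^ p ^ (m * k) = c)) :
    1 < m ∧ ∀ f ∈ MVSPset (U.image (fun u => u ^ v)),
      (¬ ∃ g ∈ MVSPset U, f = g ^ v) →
      (Real.sqrt ((p : ℝ) ^ n) + 1) * (p : ℝ) ^ (m * k) < (f.natDegree : ℝ) := by
  have : Fact p.Prime := ⟨hp⟩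
  have : CharP F p := charP_of_card_eq_prime_pow hcard
  have hk0 : k ≠ 0 := by
    rintro rfl
    have := Nat.eq_zero_of_zero_dvd hk
    omega
  have hm : 1 < m := MV.m_gt hk hk0 hcard U hU h1 hUcard hUne
  refine ⟨hm, fun f hf hne => absurd ?_ hne⟩
  exact MV.main (by omega) hk hk0 hv hvd hcard U hU h1
    (by rw [hUcard, mul_comm, pow_mul]) hm f hf
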